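/- Fix x > 0 with f̂(x) := ln(x/K) + R_d − R_f = 0 (i.e. x = K·e^{R_f − R_d}). Then each of the four third-order partial derivatives of the Black–Scholes put value blows up at y = 0: |∂_{xxx} Put_BS(x,y)| → ∞, |∂_{xxy} Put_BS(x,y)| → ∞, |∂_{xyy} Put_BS(x,y)| → ∞ and |∂_{yyy} Put_BS(x,y)| → ∞ as y → 0⁺. Moreover this is the only way the third-order partial derivatives explode: each of them still tends to 0 as y → ∞ for this x. -/

import Mathlib

open Real MeasureTheory Filter

/-- The standard normal cumulative distribution function Φ. -/
noncomputable def stdNormalCDF (x : ℝ) : ℝ :=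
  ∫ t in Set.Iic x, (Real.sqrt (2 * Real.pi))⁻¹ * Real.exp (-t ^ 2 / 2)

/-- The standard normal density φ(z) = (2π)^{−1/2} e^{−z²/2}. -/
noncomputable def stdNormalPDF (z : ℝ) : ℝ :=
  (Real.sqrt (2 * Real.pi))⁻¹ * Real.exp (-z ^ 2 / 2)

/-- d₊(x,y) = (ln(x/K) + R_d − R_f)/√y + √y/2. -/
noncomputable def dplus (K Rd Rf x y : ℝ) : ℝ :=
  (Real.log (x / K) + Rd - Rf) / Real.sqrt y + Real.sqrt y / 2

/-- d₋(x,y) = (ln(x/K) + R_d − R_f)/√y − √y/2. -/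
noncomputable def dminus (K Rd Rf x y : ℝ) : ℝ :=
  (Real.log (x / K) + Rd - Rf) / Real.sqrt y - Real.sqrt y / 2

/-- The Black–Scholes put value Put_BS(x,y). -/
noncomputable def PutBS (K Rd Rf x y : ℝ) : ℝ :=
  K * Real.exp (-Rd) * stdNormalCDF (-(dminus K Rd Rf x y))
    - x * Real.exp (-Rf) * stdNormalCDF (-(dplus K Rd Rf x y))

/-- ∂₃Put_BS/∂x³. -/
noncomputable def Pxxx (K Rd Rf x y : ℝ) : ℝ :=
  iteratedDeriv 3 (fun x' => PutBS K Rd Rf x' y) x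

/-- ∂₃Put_BS/∂x²∂y. -/
noncomputable def Pxxy (K Rd Rf x y : ℝ) : ℝ :=
  deriv (fun y' => iteratedDeriv 2 (fun x' => PutBS K Rd Rf x' y') x) y

/-- ∂₃Put_BS/∂x∂y². -/
noncomputable def Pxyy (K Rd Rf x y : ℝ) : ℝ :=
  deriv (fun x' => iteratedDeriv 2 (fun y' => PutBS K Rd Rf x' y') y) x

/-- ∂₃Put_BS/∂y³. -/
noncomputable def Pyyy (K Rd Rf x y : ℝ) : ℝ :=
  iteratedDeriv 3 (fun y' => PutBS K Rd Rf x y') y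

lemma hasDerivAt_stdNormalCDF (x : ℝ) : HasDerivAt stdNormalCDF (stdNormalPDF x) x := by
  have hcont : Continuous stdNormalPDF := by unfold stdNormalPDF; fun_prop
  have hint : Integrable stdNormalPDF := by
    have h := (integrable_exp_neg_mul_sq (b := 1 / 2) (by norm_num)).const_mul
      (Real.sqrt (2 * Real.pi))⁻¹
    refine h.congr (Eventually.of_forall fun t => ?_)
    simp only [stdNormalPDF]
    ring_nf
  have hCDF : stdNormalCDF = fun u => stdNormalCDF 0 + ∫ t in (0 : ℝ)..u, stdNormalPDF t := by
    funext u
    have h := intervalIntegral.integral_Iic_sub_Iic (μ := volume) (a := 0) (b := u)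
      hint.integrableOn hint.integrableOn
    change stdNormalCDF u - stdNormalCDF 0 = _ at h
    linarith
  rw [hCDF]
  exact (intervalIntegral.integral_hasDerivAt_right (hcont.intervalIntegrable _ _)
    (hcont.stronglyMeasurableAtFilter _ _) hcont.continuousAt).const_add _

lemma stdNormalPDF_neg (z : ℝ) : stdNormalPDF (-z) = stdNormalPDF z := by
  simp [stdNormalPDF]

lemma hasDerivAt_stdNormalPDF (z : ℝ) : HasDerivAt stdNormalPDF (-z * stdNormalPDF z) z := by
  have h := ((((hasDerivAt_id z).pow 2).neg.div_const 2).exp).const_mul (Real.sqrt (2 * Real.pi))⁻¹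
  refine h.congr_deriv ?_
  simp [stdNormalPDF]
  ring

lemma hasDerivAt_logMoneyness {K x : ℝ} (Rd Rf : ℝ) (hK : 0 < K) (hx : 0 < x) :
    HasDerivAt (fun x => Real.log (x / K) + Rd - Rf) (1 / x) x := by
  have h := ((((hasDerivAt_id x).div_const K).log (div_pos hx hK).ne').add_const Rd).sub_const Rf
  refine h.congr_deriv ?_
  simp
  field_simp

lemma hasDerivAt_dplus_spot {K x : ℝ} (Rd Rf y : ℝ) (hK : 0 < K) (hx : 0 < x) :
    HasDerivAt (fun x => dplus K Rd Rf x y) (1 / x / √y) x :=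
  ((hasDerivAt_logMoneyness Rd Rf hK hx).div_const _).add_const _

lemma hasDerivAt_dminus_spot {K x : ℝ} (Rd Rf y : ℝ) (hK : 0 < K) (hx : 0 < x) :
    HasDerivAt (fun x => dminus K Rd Rf x y) (1 / x / √y) x :=
  ((hasDerivAt_logMoneyness Rd Rf hK hx).div_const _).sub_const _

lemma hasDerivAt_dplus_variance (K Rd Rf x : ℝ) {y : ℝ} (hy : 0 < y) :
    HasDerivAt (fun y => dplus K Rd Rf x y)
      (-(Real.log (x / K) + Rd - Rf) / (2 * y * √y) + 1 / (4 * √y)) y := by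
  have hs : HasDerivAt (fun y => √y) (1 / (2 * √y)) y := Real.hasDerivAt_sqrt hy.ne'
  have hs0 : √y ≠ 0 := (Real.sqrt_pos.2 hy).ne'
  have h := ((hasDerivAt_const y (Real.log (x / K) + Rd - Rf)).div hs hs0).add (hs.div_const 2)
  refine h.congr_deriv ?_
  rw [Real.sq_sqrt hy.le]
  field_simp
  ring

lemma hasDerivAt_dminus_variance (K Rd Rf x : ℝ) {y : ℝ} (hy : 0 < y) :
    HasDerivAt (fun y => dminus K Rd Rf x y)
      (-(Real.log (x / K) + Rd - Rf) / (2 * y * √y) - 1 / (4 * √y)) y := by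
  have hs : HasDerivAt (fun y => √y) (1 / (2 * √y)) y := Real.hasDerivAt_sqrt hy.ne'
  have hs0 : √y ≠ 0 := (Real.sqrt_pos.2 hy).ne'
  have h := ((hasDerivAt_const y (Real.log (x / K) + Rd - Rf)).div hs hs0).sub (hs.div_const 2)
  refine h.congr_deriv ?_
  rw [Real.sq_sqrt hy.le]
  field_simp
  ring

lemma strike_mul_pdf_dminus {K x y : ℝ} (Rd Rf : ℝ) (hK : 0 < K) (hx : 0 < x) (hy : 0 < y) :
    K * Real.exp (-Rd) * stdNormalPDF (dminus K Rd Rf x y)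
      = x * Real.exp (-Rf) * stdNormalPDF (dplus K Rd Rf x y) := by
  have hsq : -(dminus K Rd Rf x y) ^ 2 / 2
      = -(dplus K Rd Rf x y) ^ 2 / 2 + (Real.log (x / K) + Rd - Rf) := by
    have hs0 : √y ≠ 0 := (Real.sqrt_pos.2 hy).ne'
    unfold dminus dplus
    field_simp
    ring
  have hexp : K * Real.exp (Real.log (x / K) + Rd - Rf) = x * Real.exp (-Rf) * Real.exp Rd := by
    rw [add_sub_assoc, Real.exp_add, Real.exp_log (by positivity), sub_eq_add_neg, Real.exp_add]
    field_simp
  have hRd : Real.exp Rd * Real.exp (-Rd) = 1 := by simp [← Real.exp_add]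
  unfold stdNormalPDF
  rw [hsq, Real.exp_add]
  linear_combination (Real.exp (-Rd) * (√(2 * π))⁻¹ * rexp (-dplus K Rd Rf x y ^ 2 / 2)) * hexp
    + (x * Real.exp (-Rf) * (√(2 * π))⁻¹ * rexp (-dplus K Rd Rf x y ^ 2 / 2)) * hRd

lemma hasDerivAt_PutBS_spot {K x y : ℝ} (Rd Rf : ℝ) (hK : 0 < K) (hx : 0 < x) (hy : 0 < y) :
    HasDerivAt (fun x => PutBS K Rd Rf x y)
      (-(Real.exp (-Rf) * stdNormalCDF (-(dplus K Rd Rf x y)))) x := by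
  have hm := ((hasDerivAt_stdNormalCDF _).comp x
    (hasDerivAt_dminus_spot Rd Rf y hK hx).neg).const_mul (K * Real.exp (-Rd))
  have hp := ((hasDerivAt_id x).mul_const (Real.exp (-Rf))).mul
    ((hasDerivAt_stdNormalCDF _).comp x (hasDerivAt_dplus_spot Rd Rf y hK hx).neg)
  refine (hm.sub hp).congr_deriv ?_
  simp only [Function.comp_apply, Pi.neg_apply, stdNormalPDF_neg, id]
  linear_combination (-(1 / x / √y)) * strike_mul_pdf_dminus Rd Rf hK hx hy

/-- The quantity `x e^{-R_f} φ(d₊) / √y`, in which all second-order sensitivities are expressed. -/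
noncomputable def scaledVega (K Rd Rf x y : ℝ) : ℝ :=
  x * Real.exp (-Rf) * stdNormalPDF (dplus K Rd Rf x y) / √y

lemma hasDerivAt_PutBS_variance {K x y : ℝ} (Rd Rf : ℝ) (hK : 0 < K) (hx : 0 < x) (hy : 0 < y) :
    HasDerivAt (fun y => PutBS K Rd Rf x y) (scaledVega K Rd Rf x y / 2) y := by
  have hm := ((hasDerivAt_stdNormalCDF _).comp y
    (hasDerivAt_dminus_variance K Rd Rf x hy).neg).const_mul (K * Real.exp (-Rd))
  have hp := ((hasDerivAt_stdNormalCDF _).comp y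
    (hasDerivAt_dplus_variance K Rd Rf x hy).neg).const_mul (x * Real.exp (-Rf))
  refine (hm.sub hp).congr_deriv ?_
  simp only [Pi.neg_apply, stdNormalPDF_neg, scaledVega]
  linear_combination
    (-(-(Real.log (x / K) + Rd - Rf) / (2 * y * √y) - 1 / (4 * √y))) *
      strike_mul_pdf_dminus Rd Rf hK hx hy

lemma hasDerivAt_delta_spot {K x : ℝ} (Rd Rf y : ℝ) (hK : 0 < K) (hx : 0 < x) :
    HasDerivAt (fun x => -(Real.exp (-Rf) * stdNormalCDF (-(dplus K Rd Rf x y))))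
      (scaledVega K Rd Rf x y / x ^ 2) x := by
  have hp := (((hasDerivAt_stdNormalCDF _).comp x
    (hasDerivAt_dplus_spot Rd Rf y hK hx).neg).const_mul (Real.exp (-Rf))).neg
  refine hp.congr_deriv ?_
  simp only [Pi.neg_apply, stdNormalPDF_neg, scaledVega]
  field_simp

lemma hasDerivAt_scaledVega_spot {K x y : ℝ} (Rd Rf : ℝ) (hK : 0 < K) (hx : 0 < x) (hy : 0 < y) :
    HasDerivAt (fun x => scaledVega K Rd Rf x y)
      (scaledVega K Rd Rf x y * ((1 / 2 - (Real.log (x / K) + Rd - Rf) / y) / x)) x := by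
  have h := (((hasDerivAt_id x).mul_const (Real.exp (-Rf))).mul
    ((hasDerivAt_stdNormalPDF _).comp x (hasDerivAt_dplus_spot Rd Rf y hK hx))).div_const (√y)
  refine h.congr_deriv ?_
  have hd : dplus K Rd Rf x y / √y = (Real.log (x / K) + Rd - Rf) / y + 1 / 2 := by
    have hs0 : √y ≠ 0 := (Real.sqrt_pos.2 hy).ne'
    rw [dplus, add_div, div_div, Real.mul_self_sqrt hy.le]
    field_simp
  simp only [Function.comp_apply, id, scaledVega]
  have hL : (Real.log (x / K) + Rd - Rf) / y = dplus K Rd Rf x y / √y - 1 / 2 := by linarith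
  rw [hL]
  field_simp
  ring

lemma hasDerivAt_scaledVega_variance (K Rd Rf x : ℝ) {y : ℝ} (hy : 0 < y) :
    HasDerivAt (fun y => scaledVega K Rd Rf x y)
      (scaledVega K Rd Rf x y *
        ((Real.log (x / K) + Rd - Rf) ^ 2 / (2 * y ^ 2) - 1 / 8 - 1 / (2 * y))) y := by
  have hs0 : √y ≠ 0 := (Real.sqrt_pos.2 hy).ne'
  have h := (((hasDerivAt_stdNormalPDF _).comp y
    (hasDerivAt_dplus_variance K Rd Rf x hy)).const_mul (x * Real.exp (-Rf))).div
      (Real.hasDerivAt_sqrt hy.ne') hs0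
  refine h.congr_deriv ?_
  have hd : dplus K Rd Rf x y *
      (-(Real.log (x / K) + Rd - Rf) / (2 * y * √y) + 1 / (4 * √y))
      = -((Real.log (x / K) + Rd - Rf) ^ 2 / (2 * y ^ 2)) + 1 / 8 := by
    obtain ⟨s, hs, rfl⟩ : ∃ s : ℝ, 0 < s ∧ y = s ^ 2 :=
      ⟨√y, Real.sqrt_pos.2 hy, (Real.sq_sqrt hy.le).symm⟩
    rw [dplus, Real.sqrt_sq hs.le]
    field_simp
    ring
  have hL : (Real.log (x / K) + Rd - Rf) ^ 2 / (2 * y ^ 2) = 1 / 8 - dplus K Rd Rf x y *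
      (-(Real.log (x / K) + Rd - Rf) / (2 * y * √y) + 1 / (4 * √y)) := by linarith
  simp only [Function.comp_apply, scaledVega]
  rw [hL]
  generalize -(Real.log (x / K) + Rd - Rf) / (2 * y * √y) + 1 / (4 * √y) = D
  field_simp
  rw [Real.sq_sqrt hy.le]
  ring

lemma iteratedDeriv_succ_eq_of_hasDerivAt_pos {f g : ℝ → ℝ} (n : ℕ)
    (h : ∀ t, 0 < t → HasDerivAt f (g t) t) {t : ℝ} (ht : 0 < t) :
    iteratedDeriv (n + 1) f t = iteratedDeriv n g t := by
  rw [iteratedDeriv_succ']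
  exact EventuallyEq.iteratedDeriv_eq n ((eventually_gt_nhds ht).mono fun u hu => (h u hu).deriv)

lemma iteratedDeriv_two_PutBS_spot {K x y : ℝ} (Rd Rf : ℝ) (hK : 0 < K) (hx : 0 < x)
    (hy : 0 < y) :
    iteratedDeriv 2 (fun x => PutBS K Rd Rf x y) x = scaledVega K Rd Rf x y / x ^ 2 := by
  rw [iteratedDeriv_succ_eq_of_hasDerivAt_pos 1
    (fun t ht => hasDerivAt_PutBS_spot Rd Rf hK ht hy) hx, iteratedDeriv_one]
  exact (hasDerivAt_delta_spot Rd Rf y hK hx).deriv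

lemma iteratedDeriv_two_PutBS_variance {K x y : ℝ} (Rd Rf : ℝ) (hK : 0 < K) (hx : 0 < x)
    (hy : 0 < y) :
    iteratedDeriv 2 (fun y => PutBS K Rd Rf x y) y = scaledVega K Rd Rf x y *
      ((Real.log (x / K) + Rd - Rf) ^ 2 / (2 * y ^ 2) - 1 / 8 - 1 / (2 * y)) / 2 := by
  rw [iteratedDeriv_succ_eq_of_hasDerivAt_pos 1
    (fun t ht => hasDerivAt_PutBS_variance Rd Rf hK hx ht) hy, iteratedDeriv_one]
  exact ((hasDerivAt_scaledVega_variance K Rd Rf x hy).div_const 2).deriv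

lemma scaledVega_eq {K Rd Rf x : ℝ} (hf : Real.log (x / K) + Rd - Rf = 0) {y : ℝ} (hy : 0 < y) :
    scaledVega K Rd Rf x y
      = x * Real.exp (-Rf) * (√(2 * π))⁻¹ * (Real.exp (-y / 8) / √y) := by
  have hsq : -(√y / 2) ^ 2 / 2 = -y / 8 := by
    rw [div_pow, Real.sq_sqrt hy.le]
    ring
  rw [scaledVega, dplus, hf, zero_div, zero_add, stdNormalPDF, hsq]
  ring

lemma Pxxx_eq {K Rd Rf x : ℝ} (hK : 0 < K) (hx : 0 < x) (hf : Real.log (x / K) + Rd - Rf = 0)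
    {y : ℝ} (hy : 0 < y) : Pxxx K Rd Rf x y = scaledVega K Rd Rf x y * (-(3 / 2) / x ^ 3) := by
  rw [Pxxx, iteratedDeriv_succ]
  have heq : iteratedDeriv 2 (fun x' => PutBS K Rd Rf x' y)
      =ᶠ[nhds x] fun x' => scaledVega K Rd Rf x' y / x' ^ 2 :=
    (eventually_gt_nhds hx).mono fun t ht => iteratedDeriv_two_PutBS_spot Rd Rf hK ht hy
  rw [heq.deriv_eq]
  refine (((hasDerivAt_scaledVega_spot Rd Rf hK hx hy).div (hasDerivAt_pow 2 x)
    (by positivity)).congr_deriv ?_).deriv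
  rw [hf]
  field_simp
  ring

lemma Pxxy_eq {K Rd Rf x : ℝ} (hK : 0 < K) (hx : 0 < x) (hf : Real.log (x / K) + Rd - Rf = 0)
    {y : ℝ} (hy : 0 < y) :
    Pxxy K Rd Rf x y = scaledVega K Rd Rf x y * (-(1 / 8 + 1 / (2 * y)) / x ^ 2) := by
  have heq : (fun y' => iteratedDeriv 2 (fun x' => PutBS K Rd Rf x' y') x)
      =ᶠ[nhds y] fun y' => scaledVega K Rd Rf x y' / x ^ 2 :=
    (eventually_gt_nhds hy).mono fun t ht => iteratedDeriv_two_PutBS_spot Rd Rf hK hx ht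
  rw [Pxxy, heq.deriv_eq, ((hasDerivAt_scaledVega_variance K Rd Rf x hy).div_const _).deriv, hf]
  ring

lemma Pxyy_eq {K Rd Rf x : ℝ} (hK : 0 < K) (hx : 0 < x) (hf : Real.log (x / K) + Rd - Rf = 0)
    {y : ℝ} (hy : 0 < y) :
    Pxyy K Rd Rf x y = scaledVega K Rd Rf x y * (-(1 / 8 + 1 / (2 * y)) / (4 * x)) := by
  have heq : (fun x' => iteratedDeriv 2 (fun y' => PutBS K Rd Rf x' y') y)
      =ᶠ[nhds x] fun x' => scaledVega K Rd Rf x' y *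
        ((Real.log (x' / K) + Rd - Rf) ^ 2 / (2 * y ^ 2) - 1 / 8 - 1 / (2 * y)) / 2 :=
    (eventually_gt_nhds hx).mono fun t ht => iteratedDeriv_two_PutBS_variance Rd Rf hK ht hy
  rw [Pxyy, heq.deriv_eq]
  have h := ((hasDerivAt_scaledVega_spot Rd Rf hK hx hy).mul
    (((((hasDerivAt_logMoneyness Rd Rf hK hx).pow 2).div_const (2 * y ^ 2)).sub_const
      (1 / 8)).sub_const (1 / (2 * y)))).div_const 2
  refine (h.congr_deriv ?_).deriv
  simp only [Pi.pow_apply, hf]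
  field_simp
  ring

lemma Pyyy_eq {K Rd Rf x : ℝ} (hK : 0 < K) (hx : 0 < x) (hf : Real.log (x / K) + Rd - Rf = 0)
    {y : ℝ} (hy : 0 < y) :
    Pyyy K Rd Rf x y = scaledVega K Rd Rf x y *
      ((1 / 64 + 1 / (8 * y) + 3 / (4 * y ^ 2)) / 2) := by
  rw [Pyyy, iteratedDeriv_succ]
  have heq : iteratedDeriv 2 (fun y' => PutBS K Rd Rf x y')
      =ᶠ[nhds y] fun y' => scaledVega K Rd Rf x y' * (-(1 / 8) - y'⁻¹ / 2) / 2 :=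
    (eventually_gt_nhds hy).mono fun t ht => by
      rw [iteratedDeriv_two_PutBS_variance Rd Rf hK hx ht, hf]
      field_simp
      ring
  rw [heq.deriv_eq]
  have h := ((hasDerivAt_scaledVega_variance K Rd Rf x hy).mul
    (((hasDerivAt_inv hy.ne').div_const 2).const_sub (-(1 / 8)))).div_const 2
  refine (h.congr_deriv ?_).deriv
  rw [hf]
  field_simp
  ring

lemma tendsto_exp_div_sqrt_nhdsGT_zero :
    Tendsto (fun y => Real.exp (-y / 8) / √y) (nhdsWithin 0 (Set.Ioi 0)) atTop := by
  have hexp : Tendsto (fun y : ℝ => Real.exp (-y / 8)) (nhdsWithin 0 (Set.Ioi 0)) (nhds 1) := by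
    have h : Continuous fun y : ℝ => Real.exp (-y / 8) := by fun_prop
    simpa using (h.tendsto 0).mono_left nhdsWithin_le_nhds
  have hsqrt : Tendsto (fun y : ℝ => √y) (nhdsWithin 0 (Set.Ioi 0))
      (nhdsWithin 0 (Set.Ioi 0)) := by
    refine tendsto_nhdsWithin_iff.2 ⟨?_, ?_⟩
    · simpa using (Real.continuous_sqrt.tendsto 0).mono_left nhdsWithin_le_nhds
    · filter_upwards [self_mem_nhdsWithin] with y hy using Real.sqrt_pos.2 hy
  exact hexp.pos_mul_atTop one_pos (tendsto_inv_nhdsGT_zero.comp hsqrt)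

lemma tendsto_exp_div_sqrt_atTop :
    Tendsto (fun y => Real.exp (-y / 8) / √y) atTop (nhds 0) := by
  have hexp : Tendsto (fun y : ℝ => Real.exp (-y / 8)) atTop (nhds 0) :=
    Real.tendsto_exp_atBot.comp (tendsto_neg_atTop_atBot.atBot_div_const (by norm_num))
  simpa [div_eq_mul_inv] using hexp.mul (tendsto_inv_atTop_zero.comp Real.tendsto_sqrt_atTop)

lemma tendsto_abs_atTop_and_tendsto_zero {f : ℝ → ℝ} {a b₀ b₁ b₂ : ℝ} (ha : a ≠ 0)
    (hb₀ : 0 < b₀) (hb₁ : 0 ≤ b₁) (hb₂ : 0 ≤ b₂)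
    (hf : ∀ y, 0 < y → f y = a * (Real.exp (-y / 8) / √y * (b₀ + b₁ / y + b₂ / y ^ 2))) :
    Tendsto (fun y => |f y|) (nhdsWithin 0 (Set.Ioi 0)) atTop ∧ Tendsto f atTop (nhds 0) := by
  constructor
  · refine tendsto_atTop_mono' _ ?_ (tendsto_exp_div_sqrt_nhdsGT_zero.const_mul_atTop
      (mul_pos (abs_pos.2 ha) hb₀))
    filter_upwards [self_mem_nhdsWithin] with y (hy : 0 < y)
    have hq : 0 ≤ Real.exp (-y / 8) / √y := by positivity
    have hb : b₀ ≤ b₀ + b₁ / y + b₂ / y ^ 2 := by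
      have h₁ : 0 ≤ b₁ / y := by positivity
      have h₂ : 0 ≤ b₂ / y ^ 2 := by positivity
      linarith
    rw [hf y hy, abs_mul, abs_of_nonneg (mul_nonneg hq (hb₀.le.trans hb)), mul_assoc,
      mul_comm b₀]
    gcongr
  · have h₁ : Tendsto (fun y : ℝ => b₁ / y) atTop (nhds 0) := tendsto_const_nhds.div_atTop tendsto_id
    have h₂ : Tendsto (fun y : ℝ => b₂ / y ^ 2) atTop (nhds 0) :=
      tendsto_const_nhds.div_atTop (tendsto_pow_atTop two_ne_zero)
    have h := (tendsto_exp_div_sqrt_atTop.mul ((h₁.const_add b₀).add h₂)).const_mul a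
    rw [zero_mul, mul_zero] at h
    refine h.congr' ?_
    filter_upwards [eventually_gt_atTop 0] with y hy using (hf y hy).symm

/-- For fixed x > 0 with f̂(x) = ln(x/K) + R_d − R_f = 0, each third-order partial derivative
of Put_BS blows up in absolute value as y → 0⁺, while it still tends to 0 as y → ∞. -/
theorem putBS_third_partials_blowup_of_fhat_eq_zero (K Rd Rf : ℝ) (hK : 0 < K)
    (x : ℝ) (hx : 0 < x) (hf : Real.log (x / K) + Rd - Rf = 0) :
    Tendsto (fun y => |Pxxx K Rd Rf x y|) (nhdsWithin 0 (Set.Ioi 0)) atTop ∧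
    Tendsto (fun y => |Pxxy K Rd Rf x y|) (nhdsWithin 0 (Set.Ioi 0)) atTop ∧
    Tendsto (fun y => |Pxyy K Rd Rf x y|) (nhdsWithin 0 (Set.Ioi 0)) atTop ∧
    Tendsto (fun y => |Pyyy K Rd Rf x y|) (nhdsWithin 0 (Set.Ioi 0)) atTop ∧
    Tendsto (fun y => Pxxx K Rd Rf x y) atTop (nhds 0) ∧
    Tendsto (fun y => Pxxy K Rd Rf x y) atTop (nhds 0) ∧
    Tendsto (fun y => Pxyy K Rd Rf x y) atTop (nhds 0) ∧
    Tendsto (fun y => Pyyy K Rd Rf x y) atTop (nhds 0) := by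
  have hvega : x * Real.exp (-Rf) * (√(2 * π))⁻¹ ≠ 0 := by positivity
  obtain ⟨hxxx, hxxx'⟩ := tendsto_abs_atTop_and_tendsto_zero (f := Pxxx K Rd Rf x)
    (a := -(x * Real.exp (-Rf) * (√(2 * π))⁻¹ / x ^ 3)) (b₀ := 3 / 2) (b₁ := 0) (b₂ := 0)
    (neg_ne_zero.2 (by positivity)) (by norm_num) (by norm_num) (by norm_num)
    fun y hy => by
      rw [Pxxx_eq hK hx hf hy, scaledVega_eq hf hy]
      ring
  obtain ⟨hxxy, hxxy'⟩ := tendsto_abs_atTop_and_tendsto_zero (f := Pxxy K Rd Rf x)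
    (a := -(x * Real.exp (-Rf) * (√(2 * π))⁻¹ / x ^ 2)) (b₀ := 1 / 8) (b₁ := 1 / 2) (b₂ := 0)
    (neg_ne_zero.2 (by positivity)) (by norm_num) (by norm_num) (by norm_num)
    fun y hy => by
      rw [Pxxy_eq hK hx hf hy, scaledVega_eq hf hy]
      ring
  obtain ⟨hxyy, hxyy'⟩ := tendsto_abs_atTop_and_tendsto_zero (f := Pxyy K Rd Rf x)
    (a := -(x * Real.exp (-Rf) * (√(2 * π))⁻¹ / (4 * x))) (b₀ := 1 / 8) (b₁ := 1 / 2) (b₂ := 0)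
    (neg_ne_zero.2 (by positivity)) (by norm_num) (by norm_num) (by norm_num)
    fun y hy => by
      rw [Pxyy_eq hK hx hf hy, scaledVega_eq hf hy]
      ring
  obtain ⟨hyyy, hyyy'⟩ := tendsto_abs_atTop_and_tendsto_zero (f := Pyyy K Rd Rf x)
    (a := x * Real.exp (-Rf) * (√(2 * π))⁻¹ / 2) (b₀ := 1 / 64) (b₁ := 1 / 8) (b₂ := 3 / 4)
    (by positivity) (by norm_num) (by norm_num) (by norm_num)
    fun y hy => by
      rw [Pyyy_eq hK hx hf hy, scaledVega_eq hf hy]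
      ring
  exact ⟨hxxx, hxxy, hxyy, hyyy, hxxx', hxxy', hxyy', hyyy'⟩
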